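/- arXiv:2205.05280 — 2 statements merged into one kernel-verified Lean document; each statement's English description precedes it below -/
import Mathlib

section
/- Let t₁,t₂,t₃,t₄ be nonzero real numbers (with all q-shifted factorials appearing below nonzero). For every n ∈ ℕ and all x ∈ ℝ, the weighted Askey–Wilson operator raises the degree of p_n: (D_q [w(·,t) p_n(·,t)])(x) = w(x, q^{1/2}t) · [2 q^{−n/2} (1 − q²/(t₁t₂t₃t₄)) (1 − q³/(t₁t₂t₃t₄)) / ((1 − q) ∏_{1≤j<k≤4}(1 + q/(t_j t_k)))] · p_{n+1}(x, q^{1/2}t), where q^{1/2}t = (q^{1/2}t₁, q^{1/2}t₂, q^{1/2}t₃, q^{1/2}t₄). -/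
noncomputable section

open scoped BigOperators
open Finset MeasureTheory Filter Topology

/-- The finite q-shifted factorial `(a;q)_n`. -/
def qp (q a : ℝ) (n : ℕ) : ℝ := ∏ j ∈ Finset.range n, (1 - a * q ^ j)

/-- The infinite q-shifted factorial `(a;q)_∞`. -/
def qpi (q a : ℝ) : ℝ := ∏' j : ℕ, (1 - a * q ^ j)

/-- `z(x) = x + √(x²+1)`, so that `2x = z - 1/z`. -/
def zx (x : ℝ) : ℝ := x + Real.sqrt (x ^ 2 + 1)

/-- The Askey–Wilson type polynomial `p_n(x, t)`. -/
def pAW (q t1 t2 t3 t4 : ℝ) (n : ℕ) (x : ℝ) : ℝ :=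
  (t1 / q) ^ n * qp q (-q ^ 2 / (t1 * t2)) n * qp q (-q ^ 2 / (t1 * t3)) n *
    qp q (-q ^ 2 / (t1 * t4)) n *
  ∑ k ∈ Finset.range (n + 1),
    qp q (q ^ (-(n : ℤ))) k * qp q (q ^ (n + 3) / (t1 * t2 * t3 * t4)) k *
      qp q (-q / (t1 * zx x)) k * qp q (q * zx x / t1) k * q ^ k /
    (qp q q k * qp q (-q ^ 2 / (t1 * t2)) k * qp q (-q ^ 2 / (t1 * t3)) k *
      qp q (-q ^ 2 / (t1 * t4)) k)

/-- The normalized weight function `w(x, t)`. -/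
def wAW (q t1 t2 t3 t4 : ℝ) (x : ℝ) : ℝ :=
  2 * zx x * qpi q (t1 * t2 * t3 * t4 / q ^ 3) *
    (qpi q (-t1 * zx x) * qpi q (t1 / zx x) * qpi q (-t2 * zx x) * qpi q (t2 / zx x) *
      qpi q (-t3 * zx x) * qpi q (t3 / zx x) * qpi q (-t4 * zx x) * qpi q (t4 / zx x)) /
  (qpi q q * qpi q (-(zx x) ^ 2) * qpi q (-q / (zx x) ^ 2) * Real.log (1 / q) *
    (qpi q (-t1 * t2 / q) * qpi q (-t1 * t3 / q) * qpi q (-t1 * t4 / q) *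
      qpi q (-t2 * t3 / q) * qpi q (-t2 * t4 / q) * qpi q (-t3 * t4 / q)))

/-- The Askey–Wilson divided difference operator `D_q`. -/
def Dq (q : ℝ) (f : ℝ → ℝ) (x : ℝ) : ℝ :=
  (f ((Real.sqrt q * zx x - 1 / (Real.sqrt q * zx x)) / 2) -
    f ((zx x / Real.sqrt q - Real.sqrt q / zx x) / 2)) /
  ((Real.sqrt q - 1 / Real.sqrt q) * (zx x + 1 / zx x) / 2)

/-- The averaging operator `A_q`. -/
def Aqop (q : ℝ) (f : ℝ → ℝ) (x : ℝ) : ℝ :=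
  (f ((Real.sqrt q * zx x - 1 / (Real.sqrt q * zx x)) / 2) +
    f ((zx x / Real.sqrt q - Real.sqrt q / zx x) / 2)) / 2

lemma qpi_eq_mul (q : ℝ) (hq0 : 0 < q) (hq1 : q < 1) {a b : ℝ} (h : b = a * q) :
    qpi q a = (1 - a) * qpi q b := by
  have hs : Summable fun j : ℕ => -(b * q ^ j) :=
    ((summable_geometric_of_lt_one hq0.le hq1).mul_left b).neg
  have hm : Multipliable fun j : ℕ => 1 - a * q ^ (j + 1) := by
    have := Real.multipliable_one_add_of_summable hs
    refine this.congr fun j => ?_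
    rw [h]; ring
  unfold qpi
  rw [tprod_eq_zero_mul' (f := fun j : ℕ => 1 - a * q ^ j) hm]
  simp only [pow_zero, mul_one]
  congr 1
  refine tprod_congr fun j => ?_
  rw [h]; ring

lemma qp_succ (q a : ℝ) (k : ℕ) : qp q a (k + 1) = qp q a k * (1 - a * q ^ k) :=
  Finset.prod_range_succ _ _

lemma qp_succ_eq_mul (q : ℝ) {a b : ℝ} (h : b = a * q) (k : ℕ) :
    qp q a (k + 1) = (1 - a) * qp q b k := by
  unfold qp
  rw [Finset.prod_range_succ', mul_comm]
  simp only [pow_zero, mul_one]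
  congr 1
  refine Finset.prod_congr rfl fun j _ => ?_
  rw [h]; ring

lemma one_sub_mul_qp (q : ℝ) {a b : ℝ} (h : b = a * q) (k : ℕ) :
    (1 - a) * qp q b k = qp q a k * (1 - a * q ^ k) := by
  rw [← qp_succ_eq_mul q h, qp_succ]

lemma qp_self_ne_zero {q : ℝ} (hq0 : 0 < q) (hq1 : q < 1) (k : ℕ) : qp q q k ≠ 0 := by
  refine Finset.prod_ne_zero_iff.2 fun j _ => ?_
  have : q * q ^ j < 1 := by
    rw [← pow_succ']; exact pow_lt_one₀ hq0.le hq1 (by omega)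
  linarith

lemma zx_pos (x : ℝ) : 0 < zx x := by
  unfold zx
  have : |x| < Real.sqrt (x ^ 2 + 1) := by
    rw [← Real.sqrt_sq_eq_abs]
    exact Real.sqrt_lt_sqrt (sq_nonneg x) (by linarith)
  linarith [neg_abs_le x]

lemma zx_sub_inv_div_two {u : ℝ} (hu : 0 < u) : zx ((u - 1 / u) / 2) = u := by
  unfold zx
  have : ((u - 1 / u) / 2) ^ 2 + 1 = ((u + 1 / u) / 2) ^ 2 := by field_simp; ring
  rw [this, Real.sqrt_sq (by positivity)]
  ring

/-- The weight `wAW` as a function of `z = zx x`. -/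
def weightZ (q t1 t2 t3 t4 z : ℝ) : ℝ :=
  2 * z * qpi q (t1 * t2 * t3 * t4 / q ^ 3) *
    (qpi q (-t1 * z) * qpi q (t1 / z) * qpi q (-t2 * z) * qpi q (t2 / z) *
      qpi q (-t3 * z) * qpi q (t3 / z) * qpi q (-t4 * z) * qpi q (t4 / z)) /
  (qpi q q * qpi q (-z ^ 2) * qpi q (-q / z ^ 2) * Real.log (1 / q) *
    (qpi q (-t1 * t2 / q) * qpi q (-t1 * t3 / q) * qpi q (-t1 * t4 / q) *
      qpi q (-t2 * t3 / q) * qpi q (-t2 * t4 / q) * qpi q (-t3 * t4 / q)))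

/-- The ratio of the `z`-independent factors of the weights at `t` and at `q^{1/2} t`. -/
def weightRatio (q t1 t2 t3 t4 : ℝ) : ℝ :=
  (1 - t1 * t2 * t3 * t4 / q ^ 3) * (1 - t1 * t2 * t3 * t4 / q ^ 2) /
    ((1 + t1 * t2 / q) * (1 + t1 * t3 / q) * (1 + t1 * t4 / q) *
      (1 + t2 * t3 / q) * (1 + t2 * t4 / q) * (1 + t3 * t4 / q))

lemma qpi_pair_div {s : ℝ} (hs0 : 0 < s) (hs1 : s < 1) (a b : ℝ) :
    qpi (s ^ 2) (-a * b / s ^ 2) =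
      (1 + a * b / s ^ 2) * qpi (s ^ 2) (-(s * a) * (s * b) / s ^ 2) := by
  rw [qpi_eq_mul (s ^ 2) (by positivity) (by nlinarith)
    (b := -(s * a) * (s * b) / s ^ 2) (by field_simp)]
  ring

lemma qpi_quad_div {s : ℝ} (hs0 : 0 < s) (hs1 : s < 1) (t1 t2 t3 t4 : ℝ) :
    qpi (s ^ 2) (t1 * t2 * t3 * t4 / (s ^ 2) ^ 3) =
      (1 - t1 * t2 * t3 * t4 / (s ^ 2) ^ 3) * ((1 - t1 * t2 * t3 * t4 / (s ^ 2) ^ 2) *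
        qpi (s ^ 2) (s * t1 * (s * t2) * (s * t3) * (s * t4) / (s ^ 2) ^ 3)) := by
  have hq : s ^ 2 < 1 := by nlinarith
  rw [qpi_eq_mul (s ^ 2) (by positivity) hq
      (b := t1 * t2 * t3 * t4 / (s ^ 2) ^ 2) (by field_simp),
    qpi_eq_mul (s ^ 2) (by positivity) hq (a := t1 * t2 * t3 * t4 / (s ^ 2) ^ 2)
      (b := s * t1 * (s * t2) * (s * t3) * (s * t4) / (s ^ 2) ^ 3) (by field_simp)]

lemma weightZ_mul {s : ℝ} (hs0 : 0 < s) (hs1 : s < 1) (t1 t2 t3 t4 : ℝ)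
    {z : ℝ} (hz : 0 < z) :
    weightZ (s ^ 2) t1 t2 t3 t4 (s * z) =
      weightZ (s ^ 2) (s * t1) (s * t2) (s * t3) (s * t4) z * weightRatio (s ^ 2) t1 t2 t3 t4 *
        (s * (z ^ 2 * ((1 - t1 / (s * z)) * (1 - t2 / (s * z)) * (1 - t3 / (s * z)) *
          (1 - t4 / (s * z))))) := by
  have hq : s ^ 2 < 1 := by nlinarith
  have hq0 : 0 < s ^ 2 := by positivity
  have hnum (t : ℝ) :
      qpi (s ^ 2) (t / (s * z)) = (1 - t / (s * z)) * qpi (s ^ 2) (s * t / z) :=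
    qpi_eq_mul _ hq0 hq (by field_simp)
  have harg (t : ℝ) : -t * (s * z) = -(s * t) * z := by ring
  have hd1 : qpi (s ^ 2) (-z ^ 2) = (1 + z ^ 2) * qpi (s ^ 2) (-(s * z) ^ 2) := by
    rw [qpi_eq_mul _ hq0 hq (b := -(s * z) ^ 2) (by ring)]; ring
  have hd2 : qpi (s ^ 2) (-s ^ 2 / (s * z) ^ 2) =
      ((1 + z ^ 2) * (z ^ 2)⁻¹) * qpi (s ^ 2) (-s ^ 2 / z ^ 2) := by
    rw [qpi_eq_mul _ hq0 hq (b := -s ^ 2 / z ^ 2) (by field_simp)]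
    congr 1; field_simp; ring
  unfold weightZ weightRatio
  rw [qpi_quad_div hs0 hs1, hd1, hd2]
  rw [qpi_pair_div hs0 hs1 t1 t2, qpi_pair_div hs0 hs1 t1 t3, qpi_pair_div hs0 hs1 t1 t4,
    qpi_pair_div hs0 hs1 t2 t3, qpi_pair_div hs0 hs1 t2 t4, qpi_pair_div hs0 hs1 t3 t4]
  simp only [hnum, harg]
  simp only [div_eq_mul_inv, mul_inv, inv_inv]
  ring

lemma weightZ_div {s : ℝ} (hs0 : 0 < s) (hs1 : s < 1) (t1 t2 t3 t4 : ℝ)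
    {z : ℝ} (hz : 0 < z) :
    weightZ (s ^ 2) t1 t2 t3 t4 (z / s) =
      weightZ (s ^ 2) (s * t1) (s * t2) (s * t3) (s * t4) z * weightRatio (s ^ 2) t1 t2 t3 t4 *
        (s * (1 / z ^ 2 * ((1 + t1 * z / s) * (1 + t2 * z / s) * (1 + t3 * z / s) *
          (1 + t4 * z / s)))) := by
  have hq : s ^ 2 < 1 := by nlinarith
  have hq0 : 0 < s ^ 2 := by positivity
  have hnum (t : ℝ) :
      qpi (s ^ 2) (-t * (z / s)) = (1 + t * z / s) * qpi (s ^ 2) (-(s * t) * z) := by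
    rw [qpi_eq_mul _ hq0 hq (b := -(s * t) * z) (by field_simp)]; ring
  have harg (t : ℝ) : t / (z / s) = s * t / z := by field_simp
  have hd1 : qpi (s ^ 2) (-(z / s) ^ 2) =
      (1 + s ^ 2 / z ^ 2) * (z / s) ^ 2 * qpi (s ^ 2) (-z ^ 2) := by
    rw [qpi_eq_mul _ hq0 hq (b := -z ^ 2) (by field_simp)]
    congr 1; field_simp; ring
  have hd2 : qpi (s ^ 2) (-s ^ 2 / z ^ 2) =
      (1 + s ^ 2 / z ^ 2) * qpi (s ^ 2) (-s ^ 2 / (z / s) ^ 2) := by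
    rw [qpi_eq_mul _ hq0 hq (b := -s ^ 2 / (z / s) ^ 2) (by field_simp)]
    ring
  have hcancel (P N Q A c B L F : ℝ) :
      2 * (z / s) * P * N / (Q * (c * (z / s) ^ 2 * A) * B * L * F) =
        2 * z * P * N / (Q * A * (c * B) * L * F) * (s * (1 / z ^ 2)) := by
    field_simp
  unfold weightZ weightRatio
  rw [qpi_quad_div hs0 hs1, hd1, hd2, hcancel]
  rw [qpi_pair_div hs0 hs1 t1 t2, qpi_pair_div hs0 hs1 t1 t3, qpi_pair_div hs0 hs1 t1 t4,
    qpi_pair_div hs0 hs1 t2 t3, qpi_pair_div hs0 hs1 t2 t4, qpi_pair_div hs0 hs1 t3 t4]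
  simp only [hnum, harg]
  simp only [div_eq_mul_inv, mul_inv]
  ring

/-- The basis function `(-q/(t z), q z/t; q)_k`. -/
def basisZ (q t z : ℝ) (k : ℕ) : ℝ := qp q (-q / (t * z)) k * qp q (q * z / t) k

/-- The coefficient of `basisZ q t1 z k` in the sum defining `pAW`. -/
def coeffAW (q t1 t2 t3 t4 : ℝ) (n k : ℕ) : ℝ :=
  qp q (q ^ (-(n : ℤ))) k * qp q (q ^ (n + 3) / (t1 * t2 * t3 * t4)) k * q ^ k /
    (qp q q k * qp q (-q ^ 2 / (t1 * t2)) k * qp q (-q ^ 2 / (t1 * t3)) k *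
      qp q (-q ^ 2 / (t1 * t4)) k)

/-- The numerator, up to the weight, of the Askey–Wilson operator applied to `w f`. -/
def weightedDiff (s t1 t2 t3 t4 : ℝ) (f : ℝ → ℝ) (z : ℝ) : ℝ :=
  s * (z ^ 2 * ((1 - t1 / (s * z)) * (1 - t2 / (s * z)) * (1 - t3 / (s * z)) *
    (1 - t4 / (s * z)))) * f (s * z) -
  s * (1 / z ^ 2 * ((1 + t1 * z / s) * (1 + t2 * z / s) * (1 + t3 * z / s) *
    (1 + t4 * z / s))) * f (z / s)

lemma weightedDiff_basisZ {s t1 : ℝ} (hs : s ≠ 0) (ht1 : t1 ≠ 0) (t2 t3 t4 : ℝ) {z : ℝ}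
    (hz : z ≠ 0) (k : ℕ) :
    weightedDiff s t1 t2 t3 t4 (fun u => basisZ (s ^ 2) t1 u k) z =
      (z + 1 / z) *
        (-((s ^ 2) ^ (2 * k + 1) / t1) * ((1 + t1 * t2 / (s ^ 2) ^ (k + 1)) *
            (1 + t1 * t3 / (s ^ 2) ^ (k + 1)) * (1 + t1 * t4 / (s ^ 2) ^ (k + 1))) *
            basisZ (s ^ 2) (s * t1) z k +
          -t1 * (1 - t1 * t2 * t3 * t4 / (s ^ 2) ^ (k + 2)) *
            basisZ (s ^ 2) (s * t1) z (k + 1)) := by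
  have h1 := one_sub_mul_qp (s ^ 2) (a := s ^ 2 * z / (s * t1)) (b := s ^ 2 * (s * z) / t1)
    (by field_simp) k
  have h2 := one_sub_mul_qp (s ^ 2) (a := -s ^ 2 / (s * t1 * z)) (b := -s ^ 2 / (t1 * (z / s)))
    (by field_simp) k
  have e1 : -s ^ 2 / (t1 * (s * z)) = -s ^ 2 / (s * t1 * z) := by ring
  have e2 : s ^ 2 * (z / s) / t1 = s ^ 2 * z / (s * t1) := by field_simp
  unfold weightedDiff basisZ
  simp only [qp_succ, e1, e2]
  generalize qp (s ^ 2) (s ^ 2 * (s * z) / t1) k = B' at *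
  generalize qp (s ^ 2) (-s ^ 2 / (t1 * (z / s))) k = A' at *
  generalize qp (s ^ 2) (s ^ 2 * z / (s * t1)) k = B at *
  generalize qp (s ^ 2) (-s ^ 2 / (s * t1 * z)) k = A at *
  have hp1 : (s ^ 2) ^ (2 * k + 1) = ((s ^ 2) ^ k) ^ 2 * s ^ 2 := by ring
  have hp2 : (s ^ 2) ^ (k + 1) = (s ^ 2) ^ k * s ^ 2 := by ring
  have hp3 : (s ^ 2) ^ (k + 2) = (s ^ 2) ^ k * s ^ 4 := by ring
  have hK : (s ^ 2) ^ k ≠ 0 := by positivity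
  rw [hp1, hp2, hp3]
  generalize (s ^ 2) ^ k = K at *
  have h1' : (1 - t1 / (s * z)) * B' = -(t1 / (s * z)) * (B * (1 - s ^ 2 * z / (s * t1) * K)) := by
    rw [← h1]; field_simp; ring
  have h2' : (1 + t1 * z / s) * A' =
      (t1 * z / s) * (A * (1 - -s ^ 2 / (s * t1 * z) * K)) := by
    rw [← h2]; field_simp; ring
  have aux : ∀ X Y : ℝ, X = -(t1 / (s * z)) * (B * (1 - s ^ 2 * z / (s * t1) * K)) →
      Y = (t1 * z / s) * (A * (1 - -s ^ 2 / (s * t1 * z) * K)) →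
      s * z ^ 2 * ((1 - t2 / (s * z)) * (1 - t3 / (s * z)) * (1 - t4 / (s * z))) * A * X -
        s * (1 / z ^ 2) * ((1 + t2 * z / s) * (1 + t3 * z / s) * (1 + t4 * z / s)) * B * Y =
      (z + 1 / z) *
        (-(K ^ 2 * s ^ 2 / t1) * ((1 + t1 * t2 / (K * s ^ 2)) *
            (1 + t1 * t3 / (K * s ^ 2)) * (1 + t1 * t4 / (K * s ^ 2))) * (A * B) +
          -t1 * (1 - t1 * t2 * t3 * t4 / (K * s ^ 4)) *
            (A * (1 - -s ^ 2 / (s * t1 * z) * K) * (B * (1 - s ^ 2 * z / (s * t1) * K)))) := by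
    rintro X Y rfl rfl
    field_simp
    ring
  rw [← aux _ _ h1' h2']
  ring

lemma one_sub_qp_ne_zero {q a : ℝ} (h : ∀ k, qp q a k ≠ 0) (k : ℕ) : 1 - a * q ^ k ≠ 0 :=
  fun h0 => h (k + 1) (by rw [qp_succ, h0, mul_zero])

lemma coeffAW_zero (q t1 t2 t3 t4 : ℝ) (n : ℕ) : coeffAW q t1 t2 t3 t4 n 0 = 1 := by
  simp [coeffAW, qp]

lemma coeffAW_self_succ {q : ℝ} (hq : q ≠ 0) (t1 t2 t3 t4 : ℝ) (n : ℕ) :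
    coeffAW q t1 t2 t3 t4 n (n + 1) = 0 := by
  have : qp q (q ^ (-(n : ℤ))) (n + 1) = 0 := by
    rw [qp_succ, zpow_neg, zpow_natCast, inv_mul_cancel₀ (pow_ne_zero n hq)]
    simp
  rw [coeffAW, this]
  simp

lemma coeffAW_succ_mul {q : ℝ} (hq0 : 0 < q) (hq1 : q < 1) {t1 t2 t3 t4 : ℝ}
    (h2 : ∀ k, qp q (-q ^ 2 / (t1 * t2)) k ≠ 0) (h3 : ∀ k, qp q (-q ^ 2 / (t1 * t3)) k ≠ 0)
    (h4 : ∀ k, qp q (-q ^ 2 / (t1 * t4)) k ≠ 0) (n k : ℕ) :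
    coeffAW q t1 t2 t3 t4 n (k + 1) * ((1 - -q ^ 2 / (t1 * t2) * q ^ k) *
        (1 - -q ^ 2 / (t1 * t3) * q ^ k) * (1 - -q ^ 2 / (t1 * t4) * q ^ k) * (1 - q * q ^ k)) =
      coeffAW q t1 t2 t3 t4 n k * ((1 - (q ^ n)⁻¹ * q ^ k) *
        (1 - q ^ (n + 3) / (t1 * t2 * t3 * t4) * q ^ k) * q) := by
  have d1 := one_sub_qp_ne_zero (qp_self_ne_zero hq0 hq1) k
  have d2 := one_sub_qp_ne_zero h2 k
  have d3 := one_sub_qp_ne_zero h3 k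
  have d4 := one_sub_qp_ne_zero h4 k
  unfold coeffAW
  rw [zpow_neg, zpow_natCast]
  simp only [qp_succ]
  generalize 1 - -q ^ 2 / (t1 * t2) * q ^ k = D2 at *
  generalize 1 - -q ^ 2 / (t1 * t3) * q ^ k = D3 at *
  generalize 1 - -q ^ 2 / (t1 * t4) * q ^ k = D4 at *
  generalize 1 - q * q ^ k = D1 at *
  generalize 1 - q ^ (n + 3) / (t1 * t2 * t3 * t4) * q ^ k = N1 at *
  generalize 1 - (q ^ n)⁻¹ * q ^ k = N2 at *
  have := qp_self_ne_zero hq0 hq1 k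
  have := h2 k
  have := h3 k
  have := h4 k
  field_simp
  ring

lemma coeffAW_shift_mul {s : ℝ} (hs0 : 0 < s) (hs1 : s < 1) {t1 t2 t3 t4 : ℝ}
    (h2 : 1 + s ^ 2 / (t1 * t2) ≠ 0) (h3 : 1 + s ^ 2 / (t1 * t3) ≠ 0)
    (h4 : 1 + s ^ 2 / (t1 * t4) ≠ 0) (n k : ℕ) :
    coeffAW (s ^ 2) (s * t1) (s * t2) (s * t3) (s * t4) (n + 1) (k + 1) *
        ((1 + s ^ 2 / (t1 * t2)) * (1 + s ^ 2 / (t1 * t3)) * (1 + s ^ 2 / (t1 * t4)) *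
          (1 - s ^ 2 * (s ^ 2) ^ k)) =
      coeffAW (s ^ 2) t1 t2 t3 t4 n k * ((1 - ((s ^ 2) ^ (n + 1))⁻¹) *
        (1 - (s ^ 2) ^ (n + 2) / (t1 * t2 * t3 * t4)) * s ^ 2) := by
  have hq0 : 0 < s ^ 2 := by positivity
  have hq1 : s ^ 2 < 1 := by nlinarith
  have d1 := one_sub_qp_ne_zero (qp_self_ne_zero hq0 hq1) k
  have hpair (t : ℝ) : qp (s ^ 2) (-(s ^ 2) ^ 2 / (s * t1 * (s * t))) (k + 1) =
      (1 + s ^ 2 / (t1 * t)) * qp (s ^ 2) (-(s ^ 2) ^ 2 / (t1 * t)) k := by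
    have e : -(s ^ 2) ^ 2 / (s * t1 * (s * t)) = -(s ^ 2 / (t1 * t)) := by
      field_simp
    rw [e, qp_succ_eq_mul (s ^ 2) (b := -(s ^ 2) ^ 2 / (t1 * t)) (by ring)]
    ring
  have hn : qp (s ^ 2) ((s ^ 2) ^ (-((n + 1 : ℕ) : ℤ))) (k + 1) =
      (1 - ((s ^ 2) ^ (n + 1))⁻¹) * qp (s ^ 2) ((s ^ 2) ^ (-(n : ℤ))) k := by
    rw [zpow_neg, zpow_natCast, zpow_neg, zpow_natCast]
    exact qp_succ_eq_mul _ (by field_simp; ring) k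
  have hT : qp (s ^ 2) ((s ^ 2) ^ (n + 1 + 3) / (s * t1 * (s * t2) * (s * t3) * (s * t4))) (k + 1) =
      (1 - (s ^ 2) ^ (n + 2) / (t1 * t2 * t3 * t4)) *
        qp (s ^ 2) ((s ^ 2) ^ (n + 3) / (t1 * t2 * t3 * t4)) k := by
    have e : (s ^ 2) ^ (n + 1 + 3) / (s * t1 * (s * t2) * (s * t3) * (s * t4)) =
        (s ^ 2) ^ (n + 2) / (t1 * t2 * t3 * t4) := by
      field_simp
      ring
    rw [e]
    exact qp_succ_eq_mul _ (by ring) k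
  unfold coeffAW
  rw [hpair, hpair, hpair, hn, hT, qp_succ (s ^ 2) (s ^ 2)]
  generalize 1 - s ^ 2 * (s ^ 2) ^ k = D1 at *
  generalize 1 + s ^ 2 / (t1 * t2) = D2 at *
  generalize 1 + s ^ 2 / (t1 * t3) = D3 at *
  generalize 1 + s ^ 2 / (t1 * t4) = D4 at *
  generalize 1 - ((s ^ 2) ^ (n + 1))⁻¹ = N1 at *
  generalize 1 - (s ^ 2) ^ (n + 2) / (t1 * t2 * t3 * t4) = N2 at *
  rw [pow_succ (s ^ 2) k]
  field_simp

lemma coeffAW_recurrence {s : ℝ} (hs0 : 0 < s) (hs1 : s < 1) {t1 t2 t3 t4 : ℝ}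
    (ht1 : t1 ≠ 0) (ht2 : t2 ≠ 0) (ht3 : t3 ≠ 0) (ht4 : t4 ≠ 0)
    (h2 : ∀ k, qp (s ^ 2) (-(s ^ 2) ^ 2 / (t1 * t2)) k ≠ 0)
    (h3 : ∀ k, qp (s ^ 2) (-(s ^ 2) ^ 2 / (t1 * t3)) k ≠ 0)
    (h4 : ∀ k, qp (s ^ 2) (-(s ^ 2) ^ 2 / (t1 * t4)) k ≠ 0)
    (r2 : 1 + s ^ 2 / (t1 * t2) ≠ 0) (r3 : 1 + s ^ 2 / (t1 * t3) ≠ 0)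
    (r4 : 1 + s ^ 2 / (t1 * t4) ≠ 0) (n k : ℕ) :
    -((s ^ 2) ^ (2 * (k + 1) + 1) / t1) * ((1 + t1 * t2 / (s ^ 2) ^ (k + 1 + 1)) *
        (1 + t1 * t3 / (s ^ 2) ^ (k + 1 + 1)) * (1 + t1 * t4 / (s ^ 2) ^ (k + 1 + 1))) *
        coeffAW (s ^ 2) t1 t2 t3 t4 n (k + 1) +
      -t1 * (1 - t1 * t2 * t3 * t4 / (s ^ 2) ^ (k + 2)) * coeffAW (s ^ 2) t1 t2 t3 t4 n k =
    -(t1 * (t1 * t2 * t3 * t4) / (s ^ 2) ^ 2) * ((1 + s ^ 2 / (t1 * t2)) *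
        (1 + s ^ 2 / (t1 * t3)) * (1 + s ^ 2 / (t1 * t4))) *
      coeffAW (s ^ 2) (s * t1) (s * t2) (s * t3) (s * t4) (n + 1) (k + 1) := by
  have hq0 : 0 < s ^ 2 := by positivity
  have hq1 : s ^ 2 < 1 := by nlinarith
  have d1 := one_sub_qp_ne_zero (qp_self_ne_zero hq0 hq1) k
  have hA := coeffAW_succ_mul hq0 hq1 h2 h3 h4 n k
  have hB := coeffAW_shift_mul hs0 hs1 r2 r3 r4 n k
  have hpair (t : ℝ) (ht : t ≠ 0) : 1 + t1 * t / (s ^ 2) ^ (k + 1 + 1) =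
      t1 * t / (s ^ 2) ^ (k + 2) * (1 - -(s ^ 2) ^ 2 / (t1 * t) * (s ^ 2) ^ k) := by
    field_simp; ring
  rw [hpair t2 ht2, hpair t3 ht3, hpair t4 ht4]
  refine mul_right_cancel₀ d1 ?_
  set q := s ^ 2 with hq
  generalize coeffAW q (s * t1) (s * t2) (s * t3) (s * t4) (n + 1) (k + 1) = c' at *
  generalize coeffAW q t1 t2 t3 t4 n (k + 1) = c1 at *
  generalize coeffAW q t1 t2 t3 t4 n k = c at *
  have key : -(q ^ (2 * (k + 1) + 1) / t1) * (t1 * t2 / q ^ (k + 2) * (t1 * t3 / q ^ (k + 2)) *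
        (t1 * t4 / q ^ (k + 2))) * ((1 - (q ^ n)⁻¹ * q ^ k) *
        (1 - q ^ (n + 3) / (t1 * t2 * t3 * t4) * q ^ k) * q) +
      -t1 * (1 - t1 * t2 * t3 * t4 / q ^ (k + 2)) * (1 - q * q ^ k) =
      -(t1 * (t1 * t2 * t3 * t4) / q ^ 2) * ((1 - (q ^ (n + 1))⁻¹) *
        (1 - q ^ (n + 2) / (t1 * t2 * t3 * t4)) * q) := by
    have e1 : q ^ (2 * (k + 1) + 1) = (q ^ k) ^ 2 * q ^ 3 := by ring
    have e2 : q ^ (k + 2) = q ^ k * q ^ 2 := by ring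
    have e3 : q ^ (n + 3) = q ^ n * q ^ 3 := by ring
    have e4 : q ^ (n + 2) = q ^ n * q ^ 2 := by ring
    have e5 : q ^ (n + 1) = q ^ n * q := by ring
    have hK : q ^ k ≠ 0 := by positivity
    have hN : q ^ n ≠ 0 := by positivity
    rw [e1, e2, e3, e4, e5]
    generalize q ^ k = K at *
    generalize q ^ n = N at *
    field_simp
    ring
  linear_combination (-(q ^ (2 * (k + 1) + 1) / t1) * (t1 * t2 / q ^ (k + 2) *
    (t1 * t3 / q ^ (k + 2)) * (t1 * t4 / q ^ (k + 2)))) * hA +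
    (t1 * (t1 * t2 * t3 * t4) / q ^ 2) * hB + c * key

lemma weightedDiff_sum (s t1 t2 t3 t4 : ℝ) (n : ℕ) (c : ℕ → ℝ) (f : ℝ → ℕ → ℝ) (z P : ℝ) :
    weightedDiff s t1 t2 t3 t4 (fun u => P * ∑ k ∈ Finset.range n, c k * f u k) z =
      P * ∑ k ∈ Finset.range n, c k * weightedDiff s t1 t2 t3 t4 (fun u => f u k) z := by
  simp only [weightedDiff, mul_sub, Finset.sum_sub_distrib, Finset.mul_sum]
  congr 1 <;> exact Finset.sum_congr rfl fun k _ => by ring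

lemma sum_two_term_recurrence (n : ℕ) (c α β d f : ℕ → ℝ) (h0 : d 0 = α 0 * c 0)
    (hs : ∀ k, α (k + 1) * c (k + 1) + β k * c k = d (k + 1)) (hn : c (n + 1) = 0) :
    ∑ k ∈ Finset.range (n + 1), c k * (α k * f k + β k * f (k + 1)) =
      ∑ k ∈ Finset.range (n + 2), d k * f k := by
  rw [Finset.sum_range_succ' (fun k => d k * f k)]
  simp only [← hs, h0, mul_add, add_mul, Finset.sum_add_distrib]
  have h := Finset.sum_range_succ (fun k => α k * c k * f k) (n + 1)
  rw [Finset.sum_range_succ' (fun k => α k * c k * f k), hn] at h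
  have e1 : ∑ k ∈ Finset.range (n + 1), c k * (α k * f k) =
      ∑ k ∈ Finset.range (n + 1), α k * c k * f k := Finset.sum_congr rfl fun k _ => by ring
  have e2 : ∑ k ∈ Finset.range (n + 1), c k * (β k * f (k + 1)) =
      ∑ k ∈ Finset.range (n + 1), β k * c k * f (k + 1) :=
    Finset.sum_congr rfl fun k _ => by ring
  rw [e1, e2]
  linear_combination -h

/-- `pAW` as a function of `z = zx x`. -/
def polyZ (q t1 t2 t3 t4 : ℝ) (n : ℕ) (z : ℝ) : ℝ :=
  (t1 / q) ^ n * qp q (-q ^ 2 / (t1 * t2)) n * qp q (-q ^ 2 / (t1 * t3)) n *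
    qp q (-q ^ 2 / (t1 * t4)) n *
    ∑ k ∈ Finset.range (n + 1), coeffAW q t1 t2 t3 t4 n k * basisZ q t1 z k

lemma weightedDiff_polyZ {s : ℝ} (hs0 : 0 < s) (hs1 : s < 1) {t1 t2 t3 t4 : ℝ}
    (ht1 : t1 ≠ 0) (ht2 : t2 ≠ 0) (ht3 : t3 ≠ 0) (ht4 : t4 ≠ 0)
    (h2 : ∀ k, qp (s ^ 2) (-(s ^ 2) ^ 2 / (t1 * t2)) k ≠ 0)
    (h3 : ∀ k, qp (s ^ 2) (-(s ^ 2) ^ 2 / (t1 * t3)) k ≠ 0)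
    (h4 : ∀ k, qp (s ^ 2) (-(s ^ 2) ^ 2 / (t1 * t4)) k ≠ 0)
    (r2 : 1 + s ^ 2 / (t1 * t2) ≠ 0) (r3 : 1 + s ^ 2 / (t1 * t3) ≠ 0)
    (r4 : 1 + s ^ 2 / (t1 * t4) ≠ 0) (n : ℕ) {z : ℝ} (hz : z ≠ 0) :
    weightedDiff s t1 t2 t3 t4 (polyZ (s ^ 2) t1 t2 t3 t4 n) z =
      (z + 1 / z) * (-(t1 * t2 * t3 * t4 / s ^ 2) / s ^ (n + 1)) *
        polyZ (s ^ 2) (s * t1) (s * t2) (s * t3) (s * t4) (n + 1) z := by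
  have hpair (t : ℝ) : qp (s ^ 2) (-(s ^ 2) ^ 2 / (s * t1 * (s * t))) (n + 1) =
      (1 + s ^ 2 / (t1 * t)) * qp (s ^ 2) (-(s ^ 2) ^ 2 / (t1 * t)) n := by
    have e : -(s ^ 2) ^ 2 / (s * t1 * (s * t)) = -(s ^ 2 / (t1 * t)) := by
      field_simp
    rw [e, qp_succ_eq_mul (s ^ 2) (b := -(s ^ 2) ^ 2 / (t1 * t)) (by ring)]
    ring
  have hsum := sum_two_term_recurrence n (coeffAW (s ^ 2) t1 t2 t3 t4 n)
    (fun k => -((s ^ 2) ^ (2 * k + 1) / t1) * ((1 + t1 * t2 / (s ^ 2) ^ (k + 1)) *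
      (1 + t1 * t3 / (s ^ 2) ^ (k + 1)) * (1 + t1 * t4 / (s ^ 2) ^ (k + 1))))
    (fun k => -t1 * (1 - t1 * t2 * t3 * t4 / (s ^ 2) ^ (k + 2)))
    (fun k => -(t1 * (t1 * t2 * t3 * t4) / (s ^ 2) ^ 2) * ((1 + s ^ 2 / (t1 * t2)) *
        (1 + s ^ 2 / (t1 * t3)) * (1 + s ^ 2 / (t1 * t4))) *
      coeffAW (s ^ 2) (s * t1) (s * t2) (s * t3) (s * t4) (n + 1) k)
    (basisZ (s ^ 2) (s * t1) z)
    (by simp only [coeffAW_zero]; field_simp; ring)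
    (fun k => coeffAW_recurrence hs0 hs1 ht1 ht2 ht3 ht4 h2 h3 h4 r2 r3 r4 n k)
    (coeffAW_self_succ (by positivity) _ _ _ _ n)
  unfold polyZ
  rw [weightedDiff_sum]
  simp only [weightedDiff_basisZ hs0.ne' ht1 t2 t3 t4 hz, hpair]
  simp only [mul_left_comm _ (z + 1 / z), ← Finset.mul_sum]
  rw [hsum]
  simp only [mul_assoc _ _ (basisZ _ _ _ _), ← Finset.mul_sum]
  have e : (s * t1 / s ^ 2) ^ (n + 1) = (t1 / s ^ 2) ^ n * s ^ (n + 1) * (t1 / s ^ 2) := by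
    rw [mul_div_assoc, mul_pow, pow_succ (t1 / s ^ 2)]; ring
  rw [e]
  generalize ∑ k ∈ Finset.range (n + 1 + 1),
    coeffAW (s ^ 2) (s * t1) (s * t2) (s * t3) (s * t4) (n + 1) k *
      basisZ (s ^ 2) (s * t1) z k = S
  generalize (t1 / s ^ 2) ^ n = U
  generalize 1 + s ^ 2 / (t1 * t2) = R2
  generalize 1 + s ^ 2 / (t1 * t3) = R3
  generalize 1 + s ^ 2 / (t1 * t4) = R4
  generalize z + 1 / z = Z
  field_simp

lemma pAW_eq_polyZ (q t1 t2 t3 t4 : ℝ) (n : ℕ) (x : ℝ) :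
    pAW q t1 t2 t3 t4 n x = polyZ q t1 t2 t3 t4 n (zx x) := by
  unfold pAW polyZ coeffAW basisZ
  congr 1
  refine Finset.sum_congr rfl fun k _ => ?_
  ring

lemma weightRatio_eq {q t1 t2 t3 t4 : ℝ} (hq : q ≠ 0)
    (ht1 : t1 ≠ 0) (ht2 : t2 ≠ 0) (ht3 : t3 ≠ 0) (ht4 : t4 ≠ 0) :
    weightRatio q t1 t2 t3 t4 * (t1 * t2 * t3 * t4 / q) =
      (1 - q ^ 2 / (t1 * t2 * t3 * t4)) * (1 - q ^ 3 / (t1 * t2 * t3 * t4)) /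
        ((1 + q / (t1 * t2)) * (1 + q / (t1 * t3)) * (1 + q / (t1 * t4)) *
          (1 + q / (t2 * t3)) * (1 + q / (t2 * t4)) * (1 + q / (t3 * t4))) := by
  have hpair (a b : ℝ) (ha : a ≠ 0) (hb : b ≠ 0) :
      1 + a * b / q = a * b / q * (1 + q / (a * b)) := by
    field_simp; ring
  have hquad (m : ℕ) : 1 - t1 * t2 * t3 * t4 / q ^ m =
      -(t1 * t2 * t3 * t4 / q ^ m) * (1 - q ^ m / (t1 * t2 * t3 * t4)) := by
    field_simp; ring
  unfold weightRatio
  rw [hquad 2, hquad 3, hpair t1 t2 ht1 ht2, hpair t1 t3 ht1 ht3, hpair t1 t4 ht1 ht4,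
    hpair t2 t3 ht2 ht3, hpair t2 t4 ht2 ht4, hpair t3 t4 ht3 ht4]
  generalize 1 - q ^ 2 / (t1 * t2 * t3 * t4) = N2
  generalize 1 - q ^ 3 / (t1 * t2 * t3 * t4) = N3
  generalize 1 + q / (t1 * t2) = A
  generalize 1 + q / (t1 * t3) = B
  generalize 1 + q / (t1 * t4) = C
  generalize 1 + q / (t2 * t3) = D
  generalize 1 + q / (t2 * t4) = E
  generalize 1 + q / (t3 * t4) = F
  field_simp

theorem raising_operator
    (q : ℝ) (hq0 : 0 < q) (hq1 : q < 1) (t1 t2 t3 t4 : ℝ)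
    (ht1 : t1 ≠ 0) (ht2 : t2 ≠ 0) (ht3 : t3 ≠ 0) (ht4 : t4 ≠ 0)
    (hne : ∀ k : ℕ,
      qp q (-q ^ 2 / (t1 * t2)) k ≠ 0 ∧ qp q (-q ^ 2 / (t1 * t3)) k ≠ 0 ∧
      qp q (-q ^ 2 / (t1 * t4)) k ≠ 0 ∧ qp q (-q ^ 2 / (t2 * t3)) k ≠ 0 ∧
      qp q (-q ^ 2 / (t2 * t4)) k ≠ 0 ∧ qp q (-q ^ 2 / (t3 * t4)) k ≠ 0 ∧
      qp q (-q / (t1 * t2)) k ≠ 0 ∧ qp q (-q / (t1 * t3)) k ≠ 0 ∧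
      qp q (-q / (t1 * t4)) k ≠ 0 ∧ qp q (-q / (t2 * t3)) k ≠ 0 ∧
      qp q (-q / (t2 * t4)) k ≠ 0 ∧ qp q (-q / (t3 * t4)) k ≠ 0) :
    ∀ n : ℕ, ∀ x : ℝ,
      Dq q (fun y => wAW q t1 t2 t3 t4 y * pAW q t1 t2 t3 t4 n y) x =
        wAW q (Real.sqrt q * t1) (Real.sqrt q * t2) (Real.sqrt q * t3)
            (Real.sqrt q * t4) x *
          (2 * q ^ (-(n : ℝ) / 2) * (1 - q ^ 2 / (t1 * t2 * t3 * t4)) *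
              (1 - q ^ 3 / (t1 * t2 * t3 * t4)) /
            ((1 - q) *
              ((1 + q / (t1 * t2)) * (1 + q / (t1 * t3)) * (1 + q / (t1 * t4)) *
                (1 + q / (t2 * t3)) * (1 + q / (t2 * t4)) * (1 + q / (t3 * t4))))) *
          pAW q (Real.sqrt q * t1) (Real.sqrt q * t2) (Real.sqrt q * t3)
            (Real.sqrt q * t4) (n + 1) x := by
  intro n x
  obtain ⟨s, hs0, rfl⟩ : ∃ s : ℝ, 0 < s ∧ q = s ^ 2 :=
    ⟨Real.sqrt q, Real.sqrt_pos.2 hq0, (Real.sq_sqrt hq0.le).symm⟩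
  have hs1 : s < 1 := by nlinarith
  have hroot : Real.sqrt (s ^ 2) = s := Real.sqrt_sq hs0.le
  have hpow : (s ^ 2 : ℝ) ^ (-(n : ℝ) / 2) = 1 / s ^ n := by
    rw [← Real.rpow_natCast s 2, ← Real.rpow_mul hs0.le, one_div, ← Real.rpow_natCast s n,
      ← Real.rpow_neg hs0.le]
    congr 1
    push_cast
    ring
  have hfac {a b : ℝ} (h : qp (s ^ 2) (-s ^ 2 / (a * b)) 1 ≠ 0) : 1 + s ^ 2 / (a * b) ≠ 0 := by
    intro h0
    apply h
    simp only [qp, Finset.prod_range_one, pow_zero, mul_one]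
    linear_combination h0
  obtain ⟨-, -, -, -, -, -, r2, r3, r4, -⟩ := hne 1
  have hz := zx_pos x
  have hdiff := weightedDiff_polyZ hs0 hs1 ht1 ht2 ht3 ht4 (fun k => (hne k).1)
    (fun k => (hne k).2.1) (fun k => (hne k).2.2.1) (hfac r2) (hfac r3) (hfac r4) n hz.ne'
  have hw (y : ℝ) (a b c d : ℝ) : wAW (s ^ 2) a b c d y = weightZ (s ^ 2) a b c d (zx y) := rfl
  have harg : zx x / s - s / zx x = zx x / s - 1 / (zx x / s) := by rw [one_div_div]
  have hratio := weightRatio_eq hq0.ne' ht1 ht2 ht3 ht4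
  simp only [Dq, pAW_eq_polyZ, hw, hroot, hpow]
  rw [harg, zx_sub_inv_div_two (mul_pos hs0 hz), zx_sub_inv_div_two (div_pos hz hs0),
    weightZ_mul hs0 hs1 _ _ _ _ hz, weightZ_div hs0 hs1 _ _ _ _ hz]
  generalize zx x = z at *
  generalize polyZ (s ^ 2) (s * t1) (s * t2) (s * t3) (s * t4) (n + 1) z = p' at *
  generalize weightZ (s ^ 2) (s * t1) (s * t2) (s * t3) (s * t4) z = w' at *
  generalize weightRatio (s ^ 2) t1 t2 t3 t4 = G at *
  have hs2 : 1 - s ^ 2 ≠ 0 := by nlinarith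
  have hs3 : s - 1 / s ≠ 0 := by
    have : s - 1 / s = -(1 - s ^ 2) / s := by field_simp; ring
    rw [this]
    exact div_ne_zero (neg_ne_zero.2 hs2) hs0.ne'
  have hz2 : z + 1 / z ≠ 0 := by positivity
  calc
    _ = w' * G * ((z + 1 / z) * (-(t1 * t2 * t3 * t4 / s ^ 2) / s ^ (n + 1)) * p') /
        ((s - 1 / s) * (z + 1 / z) / 2) := by
      rw [← hdiff, weightedDiff]; ring
    _ = w' * G * (-(t1 * t2 * t3 * t4 / s ^ 2) / s ^ (n + 1) * p') * 2 / (s - 1 / s) := by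
      generalize s - 1 / s = S at *
      generalize z + 1 / z = Z at *
      field_simp
    _ = w' * (2 * (1 / s ^ n) / (1 - s ^ 2) * (G * (t1 * t2 * t3 * t4 / s ^ 2))) * p' := by
      have : s - 1 / s = -(1 - s ^ 2) / s := by field_simp; ring
      rw [this]
      field_simp
      ring
    _ = _ := by rw [hratio, div_mul_div_comm, ← mul_assoc (2 * (1 / s ^ n))]
end
end

section
/- Let f, g : ℝ → ℂ be continuous functions such that the four integrals ∫_0^∞ |f̆(z) ğ(q^{1/2} z)| dz/z, ∫_0^∞ |f̆(z) ğ(q^{−1/2} z)| dz/z, ∫_0^∞ |f̆(q^{1/2} z) ğ(z)| dz/z and ∫_0^∞ |f̆(q^{−1/2} z) ğ(z)| dz/z are finite. Then ∫_ℝ (D_q f)(x) g(x) dx = − ∫_ℝ (D_q g)(x) f(x) dx, both integrals being absolutely convergent. -/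
noncomputable section

open scoped BigOperators
open Finset MeasureTheory Filter Topology

/-- The Askey–Wilson divided difference operator `D_q` for complex-valued functions. -/
def DqC (q : ℝ) (f : ℝ → ℂ) (x : ℝ) : ℂ :=
  (f ((Real.sqrt q * zx x - 1 / (Real.sqrt q * zx x)) / 2) -
    f ((zx x / Real.sqrt q - Real.sqrt q / zx x) / 2)) /
  (((Real.sqrt q - 1 / Real.sqrt q) * (zx x + 1 / zx x) / 2 : ℝ) : ℂ)

theorem zx_half_sub_inv {z : ℝ} (hz : 0 < z) : zx ((z - 1 / z) / 2) = z := by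
  have h : ((z - 1 / z) / 2) ^ 2 + 1 = ((z + 1 / z) / 2) ^ 2 := by
    field_simp
    ring
  rw [zx, h, Real.sqrt_sq (by positivity)]
  ring

theorem hasDerivAt_half_sub_inv {z : ℝ} (hz : 0 < z) :
    HasDerivAt (fun z : ℝ => (z - 1 / z) / 2) ((1 + 1 / z ^ 2) / 2) z := by
  simp only [one_div]
  have h := ((hasDerivAt_id' z).fun_sub (hasDerivAt_inv hz.ne')).div_const 2
  rwa [sub_neg_eq_add] at h

theorem injOn_half_sub_inv : Set.InjOn (fun z : ℝ => (z - 1 / z) / 2) (Set.Ioi 0) := by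
  intro a ha b hb hab
  rw [← zx_half_sub_inv ha, ← zx_half_sub_inv hb]
  exact congrArg zx hab

theorem image_half_sub_inv :
    (fun z : ℝ => (z - 1 / z) / 2) '' Set.Ioi 0 = Set.univ := by
  refine Set.eq_univ_of_forall fun x => ⟨zx x, ?_, ?_⟩
  · have h : |x| < Real.sqrt (x ^ 2 + 1) := by
      rw [← Real.sqrt_sq_eq_abs]
      exact Real.sqrt_lt_sqrt (sq_nonneg x) (by linarith)
    have := neg_abs_le x
    simp only [Set.mem_Ioi, zx]
    linarith
  · have hs : Real.sqrt (x ^ 2 + 1) ^ 2 = x ^ 2 + 1 := Real.sq_sqrt (by positivity)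
    have h : 1 / zx x = Real.sqrt (x ^ 2 + 1) - x := by
      refine (eq_one_div_of_mul_eq_one_left ?_).symm
      simp only [zx]
      linear_combination hs
    simp only [h]
    simp only [zx]
    ring

/-- The substitution `x = (z - 1/z)/2` turns `(D_q f) g dx` into a measure on `(0, ∞)` that is a
multiple of `dz/z`. -/
theorem abs_deriv_smul_DqC_mul (q : ℝ) (f g : ℝ → ℂ) {z : ℝ} (hz : 0 < z) :
    |(1 + 1 / z ^ 2) / 2| • (DqC q f ((z - 1 / z) / 2) * g ((z - 1 / z) / 2)) =
      ((Real.sqrt q - 1 / Real.sqrt q : ℝ) : ℂ)⁻¹ *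
        (f ((Real.sqrt q * z - 1 / (Real.sqrt q * z)) / 2) * g ((z - 1 / z) / 2) / (z : ℂ) -
          f ((z / Real.sqrt q - Real.sqrt q / z) / 2) * g ((z - 1 / z) / 2) / (z : ℂ)) := by
  have hd : (1 + 1 / z ^ 2) / 2 = (z + 1 / z) / 2 / z := by
    field_simp
  have hw : (((z + 1 / z) / 2 : ℝ) : ℂ) ≠ 0 := by
    have : 0 < (z + 1 / z) / 2 := by positivity
    exact_mod_cast this.ne'
  rw [abs_of_pos (by positivity), DqC, zx_half_sub_inv hz, hd, mul_div_assoc (_ - _),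
    Complex.real_smul, Complex.ofReal_div _ z, Complex.ofReal_mul (_ - _)]
  generalize (((z + 1 / z) / 2 : ℝ) : ℂ) = w at hw
  generalize ((Real.sqrt q - 1 / Real.sqrt q : ℝ) : ℂ) = c
  generalize f ((Real.sqrt q * z - 1 / (Real.sqrt q * z)) / 2) = a
  generalize f ((z / Real.sqrt q - Real.sqrt q / z) / 2) = b
  generalize g ((z - 1 / z) / 2) = d
  simp only [div_eq_mul_inv, mul_inv]
  linear_combination (a - b) * c⁻¹ * d * (z : ℂ)⁻¹ * mul_inv_cancel₀ hw

theorem integrable_and_integral_DqC_mul (q : ℝ) (f g : ℝ → ℂ)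
    (h₁ : IntegrableOn
      (fun z : ℝ =>
        f ((Real.sqrt q * z - 1 / (Real.sqrt q * z)) / 2) * g ((z - 1 / z) / 2) / (z : ℂ))
      (Set.Ioi (0 : ℝ)))
    (h₂ : IntegrableOn
      (fun z : ℝ =>
        f ((z / Real.sqrt q - Real.sqrt q / z) / 2) * g ((z - 1 / z) / 2) / (z : ℂ))
      (Set.Ioi (0 : ℝ))) :
    Integrable (fun x : ℝ => DqC q f x * g x) ∧
    ∫ x : ℝ, DqC q f x * g x =
      ((Real.sqrt q - 1 / Real.sqrt q : ℝ) : ℂ)⁻¹ *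
        ((∫ z in Set.Ioi (0 : ℝ),
            f ((Real.sqrt q * z - 1 / (Real.sqrt q * z)) / 2) * g ((z - 1 / z) / 2) / (z : ℂ)) -
          ∫ z in Set.Ioi (0 : ℝ),
            f ((z / Real.sqrt q - Real.sqrt q / z) / 2) * g ((z - 1 / z) / 2) / (z : ℂ)) := by
  have hd : ∀ z ∈ Set.Ioi (0 : ℝ), HasDerivWithinAt (fun z : ℝ => (z - 1 / z) / 2)
      ((1 + 1 / z ^ 2) / 2) (Set.Ioi 0) z :=
    fun z hz => (hasDerivAt_half_sub_inv hz).hasDerivWithinAt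
  have hE : Set.EqOn _ _ (Set.Ioi (0 : ℝ)) := fun z hz => abs_deriv_smul_DqC_mul q f g hz
  constructor
  · rw [← integrableOn_univ, ← image_half_sub_inv,
      integrableOn_image_iff_integrableOn_abs_deriv_smul measurableSet_Ioi hd injOn_half_sub_inv,
      integrableOn_congr_fun hE measurableSet_Ioi]
    exact (h₁.sub h₂).const_mul _
  · rw [← setIntegral_univ, ← image_half_sub_inv,
      integral_image_eq_integral_abs_deriv_smul measurableSet_Ioi hd injOn_half_sub_inv,
      setIntegral_congr_fun measurableSet_Ioi hE, integral_const_mul, integral_sub h₁ h₂]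

/-- Invariance of `dz/z` under the scaling `z ↦ √q z`, for products of `f` and `g` transported
to `(0, ∞)`. -/
theorem integral_mul_scaled_eq {q : ℝ} (hq : 0 < q) (f g : ℝ → ℂ) :
    ∫ z in Set.Ioi (0 : ℝ),
        f ((Real.sqrt q * z - 1 / (Real.sqrt q * z)) / 2) * g ((z - 1 / z) / 2) / (z : ℂ) =
      ∫ z in Set.Ioi (0 : ℝ),
        g ((z / Real.sqrt q - Real.sqrt q / z) / 2) * f ((z - 1 / z) / 2) / (z : ℂ) := by
  have hs : 0 < Real.sqrt q := Real.sqrt_pos.2 hq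
  have h := integral_comp_mul_left_Ioi
    (fun z : ℝ => g ((z / Real.sqrt q - Real.sqrt q / z) / 2) * f ((z - 1 / z) / 2) / (z : ℂ))
    0 hs
  rw [mul_zero, eq_inv_smul_iff₀ hs.ne', ← integral_smul] at h
  rw [← h]
  refine setIntegral_congr_fun measurableSet_Ioi fun z hz => ?_
  have hz : 0 < z := hz
  have hsC : (Real.sqrt q : ℂ) ≠ 0 := by exact_mod_cast hs.ne'
  have e₁ : Real.sqrt q * z / Real.sqrt q = z := by field_simp
  have e₂ : Real.sqrt q / (Real.sqrt q * z) = 1 / z := by field_simp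
  simp only [e₁, e₂, Complex.real_smul, Complex.ofReal_mul]
  field_simp

theorem q_integration_by_parts
    (q : ℝ) (hq0 : 0 < q) (hq1 : q < 1) (f g : ℝ → ℂ)
    (hf : Continuous f) (hg : Continuous g)
    (h1 : IntegrableOn
      (fun z : ℝ =>
        f ((z - 1 / z) / 2) *
          g ((Real.sqrt q * z - 1 / (Real.sqrt q * z)) / 2) / (z : ℂ))
      (Set.Ioi (0 : ℝ)))
    (h2 : IntegrableOn
      (fun z : ℝ =>
        f ((z - 1 / z) / 2) *
          g ((z / Real.sqrt q - Real.sqrt q / z) / 2) / (z : ℂ))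
      (Set.Ioi (0 : ℝ)))
    (h3 : IntegrableOn
      (fun z : ℝ =>
        f ((Real.sqrt q * z - 1 / (Real.sqrt q * z)) / 2) *
          g ((z - 1 / z) / 2) / (z : ℂ))
      (Set.Ioi (0 : ℝ)))
    (h4 : IntegrableOn
      (fun z : ℝ =>
        f ((z / Real.sqrt q - Real.sqrt q / z) / 2) *
          g ((z - 1 / z) / 2) / (z : ℂ))
      (Set.Ioi (0 : ℝ))) :
    Integrable (fun x : ℝ => DqC q f x * g x) ∧
    Integrable (fun x : ℝ => DqC q g x * f x) ∧
    ∫ x : ℝ, DqC q f x * g x = -∫ x : ℝ, DqC q g x * f x := by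
  simp only [mul_comm (f _)] at h1 h2
  obtain ⟨i₁, e₁⟩ := integrable_and_integral_DqC_mul q f g h3 h4
  obtain ⟨i₂, e₂⟩ := integrable_and_integral_DqC_mul q g f h1 h2
  refine ⟨i₁, i₂, ?_⟩
  rw [e₁, e₂, integral_mul_scaled_eq hq0 f g, integral_mul_scaled_eq hq0 g f]
  ring
end
end
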